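/- Let n ≥ 2 be an even integer and let e_1, …, e_n be nonnegative integers with e_i ≤ 2^{n²} for all i and ∑_{i=1}^n e_i = 2A for an integer A. If the constructed scheduling instance admits a feasible schedule whose total completion time ∑_j C_j is at most V' = V_s + V_m + V_b, then there exists a set H ⊆ {1, …, n} with |H| = n/2 and ∑_{i∈H} e_i = A. -/

import Mathlib

open Classical

/-- Job set of the constructed instance: `n` medium jobs, `M = 200^(n²)` small jobs
and `M` big jobs. -/
abbrev RedJob (n : ℕ) := Fin n ⊕ Fin (200 ^ n ^ 2) ⊕ Fin (200 ^ n ^ 2)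

/-- Processing times of the constructed instance: medium job `i` has processing
time `20^(n²) + e i`, small jobs have processing time `1`, big jobs `200^(n²)`. -/
noncomputable def redProc (n : ℕ) (e : Fin n → ℕ) : RedJob n → ℝ
  | Sum.inl i => (20 : ℝ) ^ n ^ 2 + e i
  | Sum.inr (Sum.inl _) => 1
  | Sum.inr (Sum.inr _) => (200 : ℝ) ^ n ^ 2

/-- The second supply date `u₂ = (n/2)·20^(n²) + A`. -/
noncomputable def redU2 (n A : ℕ) : ℝ := ((n / 2 : ℕ) : ℝ) * (20 : ℝ) ^ n ^ 2 + A

/-- `V_s = M·u₂ + M(M+1)/2` where `M = 200^(n²)`. -/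
noncomputable def redVs (n A : ℕ) : ℝ :=
  (200 : ℝ) ^ n ^ 2 * redU2 n A +
    (200 : ℝ) ^ n ^ 2 * ((200 : ℝ) ^ n ^ 2 + 1) / 2

/-- `V_m = 2(20^(n²) + A)·((n/2)(n/2+1)/2) + (u₂ + 200^(n²))·(n/2)`. -/
noncomputable def redVm (n A : ℕ) : ℝ :=
  2 * ((20 : ℝ) ^ n ^ 2 + A) *
      (((n / 2 : ℕ) : ℝ) * (((n / 2 : ℕ) : ℝ) + 1) / 2) +
    (redU2 n A + (200 : ℝ) ^ n ^ 2) * ((n / 2 : ℕ) : ℝ)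

/-- `V_b = M·(u₂ + M + 20^(n²)·(n/2) + A) + M·(M(M+1)/2)` where `M = 200^(n²)`. -/
noncomputable def redVb (n A : ℕ) : ℝ :=
  (200 : ℝ) ^ n ^ 2 *
      (redU2 n A + (200 : ℝ) ^ n ^ 2 + (20 : ℝ) ^ n ^ 2 * ((n / 2 : ℕ) : ℝ) + A) +
    (200 : ℝ) ^ n ^ 2 * ((200 : ℝ) ^ n ^ 2 * ((200 : ℝ) ^ n ^ 2 + 1) / 2)

/-- `V' = V_s + V_m + V_b`. -/
noncomputable def redV' (n A : ℕ) : ℝ := redVs n A + redVm n A + redVb n A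

/-- Disjoint jobs that all start after `T` and end before `x` have total length `≤ x - T`. -/
theorem aux_len {J : Type*} (S p : J → ℝ) (hp : ∀ j, 0 < p j)
    (hd : ∀ j j', j ≠ j' → S j + p j ≤ S j' ∨ S j' + p j' ≤ S j) (T : ℝ) (Q : Finset J) :
    (∀ j ∈ Q, T ≤ S j) → ∀ x, T ≤ x → (∀ j ∈ Q, S j + p j ≤ x) → T + ∑ j ∈ Q, p j ≤ x := by
  induction Q using Finset.induction_on_max_value S with
  | empty => intro _ x hx _; simpa using hx
  | insert l Q hl hmax ih =>
    intro hT x hx hend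
    have h1 := ih (fun j hj => hT j (Finset.mem_insert_of_mem hj)) (S l)
      (hT l (Finset.mem_insert_self _ _)) (by
        intro j hj
        have hne : j ≠ l := by rintro rfl; exact hl hj
        rcases hd j l hne with h | h
        · exact h
        · have := hmax j hj
          have := hp l
          linarith)
    rw [Finset.sum_insert hl]
    have := hend l (Finset.mem_insert_self _ _)
    linarith

/-- The SPT-type lower bound. -/
noncomputable def auxF (P M T s m b E : ℝ) : ℝ :=
  s * T + s * (s + 1) / 2 + m * (T + s) + P * (m * (m + 1)) / 2 + b * (T + s + m * P + E)
    + M * (b * (b + 1)) / 2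

theorem aux_F {J : Type*} (S p sm md bg ee : J → ℝ) (P M : ℝ) (hP : 1 ≤ P) (hM : 1 ≤ M)
    (hd : ∀ j j', j ≠ j' → S j + p j ≤ S j' ∨ S j' + p j' ≤ S j)
    (hee : ∀ j, 0 ≤ ee j) (hPM : ∀ j, P + ee j ≤ M)
    (hp : ∀ j, p j = sm j + P * md j + ee j + M * bg j)
    (hk : ∀ j, (sm j = 1 ∧ md j = 0 ∧ bg j = 0 ∧ ee j = 0) ∨
      (sm j = 0 ∧ md j = 1 ∧ bg j = 0) ∨ (sm j = 0 ∧ md j = 0 ∧ bg j = 1 ∧ ee j = 0))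
    (T : ℝ) (Q : Finset J) :
    (∀ j ∈ Q, T ≤ S j) →
      auxF P M T (∑ j ∈ Q, sm j) (∑ j ∈ Q, md j) (∑ j ∈ Q, bg j) (∑ j ∈ Q, ee j)
        ≤ ∑ j ∈ Q, (S j + p j) := by
  have hpos : ∀ j, 0 < p j := by
    intro j
    rw [hp]
    rcases hk j with ⟨h1, h2, h3, h4⟩ | ⟨h1, h2, h3⟩ | ⟨h1, h2, h3, h4⟩
    · rw [h1, h2, h3, h4]; norm_num
    · rw [h1, h2, h3]; have := hee j; linarith
    · rw [h1, h2, h3, h4]; linarith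
  induction Q using Finset.induction_on_max_value S with
  | empty => intro _; simp [auxF]
  | insert l Q hl hmax ih =>
    intro hT
    have h1 := ih (fun j hj => hT j (Finset.mem_insert_of_mem hj))
    have h2 := aux_len S p hpos hd T Q (fun j hj => hT j (Finset.mem_insert_of_mem hj)) (S l)
      (hT l (Finset.mem_insert_self _ _)) (by
        intro j hj
        have hne : j ≠ l := by rintro rfl; exact hl hj
        rcases hd j l hne with h | h
        · exact h
        · have := hmax j hj
          have := hpos l
          linarith)
    have hsp : ∑ j ∈ Q, p j = ∑ j ∈ Q, sm j + P * ∑ j ∈ Q, md j + ∑ j ∈ Q, ee j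
        + M * ∑ j ∈ Q, bg j := by
      simp only [hp, Finset.sum_add_distrib, Finset.mul_sum]
    rw [hsp] at h2
    have hs0 : 0 ≤ ∑ j ∈ Q, sm j := Finset.sum_nonneg (fun j _ => by
      rcases hk j with h | h | h <;> rw [h.1] <;> norm_num)
    have hm0 : 0 ≤ ∑ j ∈ Q, md j := Finset.sum_nonneg (fun j _ => by
      rcases hk j with h | h | h <;> rw [h.2.1] <;> norm_num)
    have hb0 : 0 ≤ ∑ j ∈ Q, bg j := Finset.sum_nonneg (fun j _ => by
      rcases hk j with h | h | h
      · rw [h.2.2.1]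
      · rw [h.2.2]
      · rw [h.2.2.1]; norm_num)
    have he0 : 0 ≤ ∑ j ∈ Q, ee j := Finset.sum_nonneg (fun j _ => hee j)
    simp only [Finset.sum_insert hl]
    generalize ∑ j ∈ Q, sm j = s at *
    generalize ∑ j ∈ Q, md j = m at *
    generalize ∑ j ∈ Q, bg j = b at *
    generalize ∑ j ∈ Q, ee j = E at *
    generalize ∑ j ∈ Q, (S j + p j) = C at *
    have h3 := hp l
    have h4 := hPM l
    have h5 := hee l
    unfold auxF at *
    rcases hk l with ⟨a1, a2, a3, a4⟩ | ⟨a1, a2, a3⟩ | ⟨a1, a2, a3, a4⟩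
    · rw [a1, a2, a3, a4] at h3 ⊢
      have := mul_nonneg hm0 (sub_nonneg.2 hP)
      have := mul_nonneg hb0 (sub_nonneg.2 hM)
      linarith
    · rw [a1, a2, a3] at h3 ⊢
      have := mul_nonneg hb0 (sub_nonneg.2 h4)
      linarith
    · rw [a1, a2, a3, a4] at h3 ⊢
      linarith

/-- Case with a big job started early. -/
theorem aux_big (k P M A a b m E T Z Q : ℝ) (hk : 1 ≤ k) (hQ : 1 ≤ Q)
    (hZ : 10000 * k ^ 4 ≤ Z) (hPZ : P = Z * Q) (hMZ : M = Z * P)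
    (hA0 : 0 ≤ A) (hAQ : A ≤ k * Q) (ha : 0 ≤ a) (hb : 1 ≤ b) (hm : 0 ≤ m)
    (habm : a + b + m ≤ k) (hE0 : 0 ≤ E) (hE : E ≤ 2 * A)
    (hT : a + P * m + E + M * b ≤ T)
    (hle : auxF P M T (M - a) (2 * k - m) (M - b) (2 * A - E) + auxF P M 0 a m b E ≤
      (M * (k * P + A) + M * (M + 1) / 2) + (2 * (P + A) * (k * (k + 1) / 2) +
        ((k * P + A) + M) * k) + (M * ((k * P + A) + M + P * k + A) + M * (M * (M + 1) / 2))) :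
    False := by
  have hk2 : k ≤ k ^ 2 := by nlinarith
  have hk3 : k ^ 2 ≤ k ^ 3 := by nlinarith [sq_nonneg k]
  have hk4 : k ^ 3 ≤ k ^ 4 := by nlinarith [pow_pos (by linarith : (0:ℝ) < k) 3]
  have hZ1 : 10000 ≤ Z := by linarith
  have hP1 : Z ≤ P := by rw [hPZ]; nlinarith
  have hP2 : 10000 * k ^ 4 * Q ≤ P := by rw [hPZ]; nlinarith
  have hQk : ∀ x, 0 ≤ x → x ≤ x * Q := fun x hx => by nlinarith
  have hM1 : 10000 * k ^ 4 * P ≤ M := by rw [hMZ]; nlinarith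
  have hMP : 10000 * P ≤ M := by rw [hMZ]; nlinarith
  have hkQ : k * Q ≤ k ^ 4 * Q := mul_le_mul_of_nonneg_right (by linarith) (by linarith)
  have hkQ4 := hQk (k ^ 4) (by linarith)
  have hAk : A * (k * (k + 1)) ≤ 2 * (k ^ 4 * Q) := by
    have h1 : A * (k * (k + 1)) ≤ k * Q * (k * (k + 1)) :=
      mul_le_mul_of_nonneg_right hAQ (by nlinarith)
    have h2 : k * Q * (k * (k + 1)) = (k ^ 3 + k ^ 2) * Q := by ring
    have h3 : (k ^ 3 + k ^ 2) * Q ≤ (2 * k ^ 4) * Q :=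
      mul_le_mul_of_nonneg_right (by linarith) (by linarith)
    linarith
  have hPm : 0 ≤ P * m := mul_nonneg (by linarith) hm
  have haB : 0 ≤ (T - M * b) := by linarith
  have hMb0 : 0 ≤ M * b := mul_nonneg (by linarith) (by linarith)
  have hkM : k ^ 4 * M ≤ M * M / 10000 := by
    have h1 : k ^ 4 * 1 ≤ k ^ 4 * P := mul_le_mul_of_nonneg_left (by linarith) (by linarith)
    have h2 : k ^ 4 * M ≤ (M / 10000) * M :=
      mul_le_mul_of_nonneg_right (by linarith) (by linarith)
    linarith
  have hkM' : k * M ≤ k ^ 4 * M := mul_le_mul_of_nonneg_right (by linarith) (by linarith)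
  have hkM2 : k ^ 2 * M ≤ k ^ 4 * M := mul_le_mul_of_nonneg_right (by linarith) (by linarith)
  -- the right-hand side
  have hkP : k * P ≤ k ^ 4 * P := mul_le_mul_of_nonneg_right (by linarith) (by linarith)
  have hk2P : k ^ 2 * P ≤ k ^ 4 * P := mul_le_mul_of_nonneg_right (by linarith) (by linarith)
  have hu : k * P + A ≤ M / 1000 := by linarith
  have hMu : M * (k * P + A) ≤ M * (M / 1000) := mul_le_mul_of_nonneg_left hu (by linarith)
  have hku : k * (k * P + A) ≤ k * (M / 1000) := mul_le_mul_of_nonneg_left hu (by linarith)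
  have hPk : P * (k * (k + 1)) ≤ M := by
    have : P * (k * (k + 1)) = k ^ 2 * P + k * P := by ring
    linarith
  have hMM : 10000 * M ≤ M * M := mul_le_mul_of_nonneg_right (by linarith) (by linarith)
  -- the left-hand side
  have hMk : k ≤ M := by linarith
  have hk0 : (0:ℝ) ≤ k := by linarith
  have hM0' : 0 ≤ M := by linarith
  have hP0' : 0 ≤ P := by linarith
  have hb0' : 0 ≤ b := by linarith
  have h0 : 0 ≤ auxF P M 0 a m b E := by unfold auxF; positivity
  have hMa : 0 ≤ M - a := by linarith
  have hMb : 0 ≤ M - b := by linarith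
  have hm2 : 0 ≤ 2 * k - m := by linarith
  have h1 : (M - a) * (M * b) + (M - a) * (M - a) / 2 + (M - b) * (M * b + (M - a))
      + M * ((M - b) * (M - b + 1)) / 2 ≤ auxF P M T (M - a) (2 * k - m) (M - b) (2 * A - E) := by
    unfold auxF
    have q1 := mul_nonneg hMa haB
    have q2 := mul_nonneg hMb haB
    have q3 : 0 ≤ (2 * k - m) * (T + (M - a)) := mul_nonneg hm2 (by linarith)
    have q4 : 0 ≤ P * ((2 * k - m) * ((2 * k - m) + 1)) :=
      mul_nonneg (by linarith) (mul_nonneg hm2 (by linarith))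
    have q5 : 0 ≤ (M - b) * ((2 * k - m) * P + (2 * A - E)) :=
      mul_nonneg hMb (add_nonneg (mul_nonneg hm2 (by linarith)) (by linarith))
    linarith
  have hM0 : 0 ≤ M := by linarith
  have hbk : b ≤ k := by linarith
  have hak : a ≤ k := by linarith
  have r1 : M * (b * (a + b)) ≤ M * (k * k) := mul_le_mul_of_nonneg_left
    (mul_le_mul hbk (by linarith) (by linarith) hk0) hM0
  have r2 : M * a ≤ M * k := mul_le_mul_of_nonneg_left hak hM0
  have r3 : M * b ≤ M * k := mul_le_mul_of_nonneg_left hbk hM0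
  have r4 : M * M * 1 ≤ M * M * b := mul_le_mul_of_nonneg_left hb (by positivity)
  have r5 : 0 ≤ a * b := by positivity
  have r6 : 0 ≤ M * b ^ 2 := by positivity
  have r7 : 0 ≤ a ^ 2 := by positivity
  linarith

theorem aux_noBig (k P M A a m E T Z Q : ℝ) (hk : 1 ≤ k) (hQ : 1 ≤ Q)
    (hZ : 10000 * k ^ 4 ≤ Z) (hPZ : P = Z * Q) (hMZ : M = Z * P)
    (hA0 : 0 ≤ A) (hAQ : A ≤ k * Q) (ha : 0 ≤ a) (hm : 0 ≤ m)
    (habm : a + m ≤ k) (hE0 : 0 ≤ E) (hE : E ≤ 2 * A)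
    (hmk : m ≤ k - 1) (hT : k * P + A ≤ T)
    (hle : auxF P M T (M - a) (2 * k - m) M (2 * A - E) + auxF P M 0 a m 0 E ≤
      (M * (k * P + A) + M * (M + 1) / 2) + (2 * (P + A) * (k * (k + 1) / 2) +
        ((k * P + A) + M) * k) + (M * ((k * P + A) + M + P * k + A) + M * (M * (M + 1) / 2))) :
    False := by
  have hk2 : k ≤ k ^ 2 := by nlinarith
  have hk3 : k ^ 2 ≤ k ^ 3 := by nlinarith [sq_nonneg k]
  have hk4 : k ^ 3 ≤ k ^ 4 := by nlinarith [pow_pos (by linarith : (0:ℝ) < k) 3]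
  have hZ1 : 10000 ≤ Z := by linarith
  have hP1 : Z ≤ P := by rw [hPZ]; nlinarith
  have hP2 : 10000 * k ^ 4 * Q ≤ P := by rw [hPZ]; nlinarith
  have hQk : ∀ x, 0 ≤ x → x ≤ x * Q := fun x hx => by nlinarith
  have hM1 : 10000 * k ^ 4 * P ≤ M := by rw [hMZ]; nlinarith
  have hMP : 10000 * P ≤ M := by rw [hMZ]; nlinarith
  have hkQ : k * Q ≤ k ^ 4 * Q := mul_le_mul_of_nonneg_right (by linarith) (by linarith)
  have hkQ4 := hQk (k ^ 4) (by linarith)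
  have hAk : A * (k * (k + 1)) ≤ 2 * (k ^ 4 * Q) := by
    have h1 : A * (k * (k + 1)) ≤ k * Q * (k * (k + 1)) :=
      mul_le_mul_of_nonneg_right hAQ (by nlinarith)
    have h2 : k * Q * (k * (k + 1)) = (k ^ 3 + k ^ 2) * Q := by ring
    have h3 : (k ^ 3 + k ^ 2) * Q ≤ (2 * k ^ 4) * Q :=
      mul_le_mul_of_nonneg_right (by linarith) (by linarith)
    linarith
  obtain ⟨t, rfl⟩ : ∃ t, T = k * P + A + t := ⟨T - (k * P + A), by ring⟩
  obtain ⟨d, rfl⟩ : ∃ d, m = k - d := ⟨k - m, by ring⟩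
  have ht : 0 ≤ t := by linarith
  have hd1 : 1 ≤ d := by linarith
  have hda : a ≤ d := by linarith
  have hM0 : 0 ≤ M := by linarith
  have hP0 : 0 ≤ P := by linarith
  have hkP : 0 ≤ k * P := mul_nonneg (by linarith) hP0
  have s1 : 0 ≤ t * (2 * M - a + (k + d)) := mul_nonneg ht (by linarith)
  have s2 : 0 ≤ (d - a) * (k * P + A + M) := mul_nonneg (by linarith) (by linarith)
  have s3 : 0 ≤ P * d ^ 2 := by positivity
  have s4 : (k + d) * a ≤ (2 * k) * k := mul_le_mul (by linarith) (by linarith) ha (by linarith)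
  have s5 : 0 ≤ M * (P * (d - 1)) := mul_nonneg hM0 (mul_nonneg hP0 (by linarith))
  have s6 : 0 ≤ M * (P - k - A - 1) := mul_nonneg hM0 (by linarith)
  have s7 : 0 ≤ M * (k - a) := mul_nonneg hM0 (by linarith)
  have s8 : 0 ≤ M * (2 * A - E) := mul_nonneg hM0 (by linarith)
  have s9 : 0 ≤ a * (k - d) := mul_nonneg ha hm
  have s10 : 0 ≤ a ^ 2 := by positivity
  unfold auxF at hle
  nlinarith

theorem aux_exact (k P M A E T Z Q : ℝ) (hk : 1 ≤ k) (hQ : 1 ≤ Q)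
    (hZ : 10000 * k ^ 4 ≤ Z) (hPZ : P = Z * Q) (hMZ : M = Z * P)
    (hA0 : 0 ≤ A) (hAQ : A ≤ k * Q)
    (hEA : E ≤ A - 1 ∨ A + 1 ≤ E) (hT : k * P + A ≤ T) (hT' : P * k + E ≤ T)
    (hle : auxF P M T M k M (2 * A - E) + auxF P M 0 0 k 0 E ≤
      (M * (k * P + A) + M * (M + 1) / 2) + (2 * (P + A) * (k * (k + 1) / 2) +
        ((k * P + A) + M) * k) + (M * ((k * P + A) + M + P * k + A) + M * (M * (M + 1) / 2))) :
    False := by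
  have hk2 : k ≤ k ^ 2 := by nlinarith
  have hk3 : k ^ 2 ≤ k ^ 3 := by nlinarith [sq_nonneg k]
  have hk4 : k ^ 3 ≤ k ^ 4 := by nlinarith [pow_pos (by linarith : (0:ℝ) < k) 3]
  have hZ1 : 10000 ≤ Z := by linarith
  have hP1 : Z ≤ P := by rw [hPZ]; nlinarith
  have hP2 : 10000 * k ^ 4 * Q ≤ P := by rw [hPZ]; nlinarith
  have hQk : ∀ x, 0 ≤ x → x ≤ x * Q := fun x hx => by nlinarith
  have hM1 : 10000 * k ^ 4 * P ≤ M := by rw [hMZ]; nlinarith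
  have hMP : 10000 * P ≤ M := by rw [hMZ]; nlinarith
  have hkQ : k * Q ≤ k ^ 4 * Q := mul_le_mul_of_nonneg_right (by linarith) (by linarith)
  have hkQ4 := hQk (k ^ 4) (by linarith)
  have hAk : A * (k * (k + 1)) ≤ 2 * (k ^ 4 * Q) := by
    have h1 : A * (k * (k + 1)) ≤ k * Q * (k * (k + 1)) :=
      mul_le_mul_of_nonneg_right hAQ (by nlinarith)
    have h2 : k * Q * (k * (k + 1)) = (k ^ 3 + k ^ 2) * Q := by ring
    have h3 : (k ^ 3 + k ^ 2) * Q ≤ (2 * k ^ 4) * Q :=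
      mul_le_mul_of_nonneg_right (by linarith) (by linarith)
    linarith
  have hM0 : 0 ≤ M := by linarith
  unfold auxF at hle
  have s1 : 0 ≤ k * (T - (k * P + A)) := mul_nonneg (by linarith) (by linarith)
  have s2 : 0 ≤ M * (T - (k * P + A)) := mul_nonneg hM0 (by linarith)
  have s3 : 0 ≤ M * (T - (P * k + E)) := mul_nonneg hM0 (by linarith)
  rcases hEA with h | h
  · have : 0 ≤ M * (A - 1 - E) := mul_nonneg hM0 (by linarith)
    linarith
  · have : 0 ≤ M * (E - (A + 1)) := mul_nonneg hM0 (by linarith)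
    linarith

/-- If `e i ≤ 2^(n²)` for all `i` and the constructed scheduling
instance admits a feasible schedule (nonnegative start times, pairwise disjoint
processing intervals, at most `n/2` jobs starting before `u₂`) whose total
completion time is at most `V'`, then EQUAL-CARDINALITY-PARTITION has a solution:
a set `H` with `|H| = n/2` and `∑_{i∈H} e i = A`. -/
theorem schedule_implies_partition_yes (n A : ℕ) (hn : 2 ≤ n) (heven : Even n)
    (e : Fin n → ℕ) (hbound : ∀ i, e i ≤ 2 ^ n ^ 2) (hsum : ∑ i, e i = 2 * A)
    (S : RedJob n → ℝ)
    (hS0 : ∀ j, 0 ≤ S j)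
    (hdisj : ∀ j j', j ≠ j' →
      S j + redProc n e j ≤ S j' ∨ S j' + redProc n e j' ≤ S j)
    (hres : (Finset.univ.filter (fun j => S j < redU2 n A)).card ≤ n / 2)
    (hval : ∑ j, (S j + redProc n e j) ≤ redV' n A) :
    ∃ H : Finset (Fin n), H.card = n / 2 ∧ ∑ i ∈ H, e i = A := by
  obtain ⟨k, hk⟩ := heven
  have hnk : n / 2 = k := by omega
  have hk1 : 1 ≤ k := by omega
  have hk1' : (1:ℝ) ≤ k := by exact_mod_cast hk1
  let sm : RedJob n → ℝ := fun j => if (∃ i, j = Sum.inr (Sum.inl i)) then 1 else 0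
  let bg : RedJob n → ℝ := fun j => if (∃ i, j = Sum.inr (Sum.inr i)) then 1 else 0
  let md : RedJob n → ℝ := fun j => if (∃ i, j = Sum.inl i) then 1 else 0
  let ee : RedJob n → ℝ := Sum.elim (fun i => (e i : ℝ)) (fun _ => 0)
  have hQ : (1:ℝ) ≤ 2 ^ n ^ 2 := one_le_pow₀ (by norm_num)
  have hPZ : (20:ℝ) ^ n ^ 2 = 10 ^ n ^ 2 * 2 ^ n ^ 2 := by rw [← mul_pow]; norm_num
  have hMZ : (200:ℝ) ^ n ^ 2 = 10 ^ n ^ 2 * 20 ^ n ^ 2 := by rw [← mul_pow]; norm_num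
  have hZ : 10000 * (k:ℝ) ^ 4 ≤ 10 ^ n ^ 2 := by
    have h1 : (10 * k) ≤ 10 ^ k := by
      have := Nat.lt_pow_self (n := k - 1) (a := 10) (by norm_num)
      have h2 : 10 ^ k = 10 ^ (k - 1) * 10 := by rw [← pow_succ]; congr 1; omega
      omega
    have h2 : (10 * k) ^ 4 ≤ 10 ^ n ^ 2 := by
      calc (10 * k) ^ 4 ≤ (10 ^ k) ^ 4 := Nat.pow_le_pow_left h1 4
        _ = 10 ^ (k * 4) := by rw [← pow_mul]
        _ ≤ 10 ^ n ^ 2 := Nat.pow_le_pow_right (by norm_num) (by subst hk; nlinarith)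
    have h3 : ((10 * k : ℝ)) ^ 4 ≤ 10 ^ n ^ 2 := by exact_mod_cast h2
    calc 10000 * (k:ℝ) ^ 4 = (10 * k : ℝ) ^ 4 := by ring
      _ ≤ _ := h3
  have hAQ : (A:ℝ) ≤ k * 2 ^ n ^ 2 := by
    have h1 : ∑ i, e i ≤ ∑ _i : Fin n, 2 ^ n ^ 2 := Finset.sum_le_sum (fun i _ => hbound i)
    rw [hsum, Finset.sum_const, Finset.card_univ, Fintype.card_fin, smul_eq_mul] at h1
    have h2 : A ≤ k * 2 ^ n ^ 2 := by
      have : n * 2 ^ n ^ 2 = 2 * (k * 2 ^ n ^ 2) := by nth_rewrite 1 [hk]; ring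
      omega
    exact_mod_cast h2
  have hZ1 : (10000:ℝ) ≤ 10 ^ n ^ 2 := by
    have : (1:ℝ) ≤ (k:ℝ) ^ 4 := one_le_pow₀ hk1'
    linarith
  have hP1 : (1:ℝ) ≤ 20 ^ n ^ 2 := one_le_pow₀ (by norm_num)
  have hM1 : (1:ℝ) ≤ 200 ^ n ^ 2 := one_le_pow₀ (by norm_num)
  have hQP : (2:ℝ) ^ n ^ 2 ≤ 20 ^ n ^ 2 := pow_le_pow_left₀ (by norm_num) (by norm_num) _
  have hPM2 : 2 * (20:ℝ) ^ n ^ 2 ≤ 200 ^ n ^ 2 := by rw [hMZ]; nlinarith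
  have hee : ∀ j, 0 ≤ ee j := by
    rintro (i | i) <;> simp [ee]
  have hPM : ∀ j, (20:ℝ) ^ n ^ 2 + ee j ≤ 200 ^ n ^ 2 := by
    rintro (i | i)
    · have : (e i : ℝ) ≤ 2 ^ n ^ 2 := by exact_mod_cast hbound i
      simp only [ee, Sum.elim_inl]
      linarith
    · simp only [ee, Sum.elim_inr]
      linarith
  have hp : ∀ j, redProc n e j = sm j + 20 ^ n ^ 2 * md j + ee j + 200 ^ n ^ 2 * bg j := by
    rintro (i | i | i) <;> simp [sm, md, ee, bg, redProc]
  have hkind : ∀ j, (sm j = 1 ∧ md j = 0 ∧ bg j = 0 ∧ ee j = 0) ∨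
      (sm j = 0 ∧ md j = 1 ∧ bg j = 0) ∨ (sm j = 0 ∧ md j = 0 ∧ bg j = 1 ∧ ee j = 0) := by
    rintro (i | i | i) <;> simp [sm, md, ee, bg]
  have tsm : ∑ j, sm j = 200 ^ n ^ 2 := by
    simp only [sm, Fintype.sum_sum_type]
    simp
  have tmd : ∑ j, md j = 2 * (k:ℝ) := by
    simp only [md, Fintype.sum_sum_type]
    simp
    rw [hk]; push_cast; ring
  have tbg : ∑ j, bg j = 200 ^ n ^ 2 := by
    simp only [bg, Fintype.sum_sum_type]
    simp
  have tee : ∑ j, ee j = 2 * (A:ℝ) := by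
    simp only [ee, Fintype.sum_sum_type, Sum.elim_inl, Sum.elim_inr]
    simp
    exact_mod_cast hsum
  have hu2 : redU2 n A = k * 20 ^ n ^ 2 + A := by simp only [redU2, hnk]
  set B := Finset.univ.filter (fun j => S j < redU2 n A) with hB
  have split : ∀ f : RedJob n → ℝ, ∑ j ∈ Bᶜ, f j = ∑ j, f j - ∑ j ∈ B, f j := by
    intro f
    rw [← Finset.sum_add_sum_compl B f]; ring
  -- counts
  let a : ℕ := (B.filter (fun j => ∃ i, j = Sum.inr (Sum.inl i))).card
  let m : ℕ := (B.filter (fun j => ∃ i, j = Sum.inl i)).card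
  let b : ℕ := (B.filter (fun j => ∃ i, j = Sum.inr (Sum.inr i))).card
  have sa : ∑ j ∈ B, sm j = (a:ℝ) := by simp only [sm, a, Finset.sum_boole]
  have sM : ∑ j ∈ B, md j = (m:ℝ) := by simp only [md, m, Finset.sum_boole]
  have sb : ∑ j ∈ B, bg j = (b:ℝ) := by simp only [bg, b, Finset.sum_boole]
  have hcard : a + m + b ≤ k := by
    have h1 : ((a + m + b : ℕ) : ℝ) = B.card := by
      push_cast
      rw [← sa, ← sM, ← sb, ← Finset.sum_add_distrib, ← Finset.sum_add_distrib,
        Finset.cast_card]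
      refine Finset.sum_congr rfl (fun j _ => ?_)
      rcases hkind j with ⟨h1, h2, h3, _⟩ | ⟨h1, h2, h3⟩ | ⟨h1, h2, h3, _⟩ <;>
        rw [h1, h2, h3] <;> norm_num
    have h2 : a + m + b = B.card := by exact_mod_cast h1
    omega
  let H : Finset (Fin n) := Finset.univ.filter (fun i => S (Sum.inl i) < redU2 n A)
  have hBsum : ∀ f : RedJob n → ℝ, (∀ j, f (Sum.inr j) = 0) →
      ∑ j ∈ B, f j = ∑ i ∈ H, f (Sum.inl i) := by
    intro f hf
    rw [hB, Finset.sum_filter, Fintype.sum_sum_type, Finset.sum_filter]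
    simp [hf]
  have hHm : m = H.card := by
    have h1 : (m:ℝ) = H.card := by
      rw [← sM, hBsum md (fun j => by simp [md])]
      simp [md]
    exact_mod_cast h1
  have hHe : ∑ j ∈ B, ee j = ((∑ i ∈ H, e i : ℕ) : ℝ) := by
    rw [hBsum ee (fun j => by simp [ee])]
    simp [ee]
  set E : ℕ := ∑ i ∈ H, e i with hE
  have hE2 : E ≤ 2 * A := by
    rw [← hsum]
    exact Finset.sum_le_sum_of_subset (Finset.subset_univ _)
  have hpos : ∀ j, 0 < redProc n e j := by
    rintro (i | i | i) <;> simp only [redProc] <;> positivity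
  -- total length of the early jobs
  have spB : ∑ j ∈ B, redProc n e j = a + 20 ^ n ^ 2 * (m:ℝ) + E + 200 ^ n ^ 2 * b := by
    rw [← sa, ← sM, ← sb, ← hHe]
    simp only [hp, Finset.sum_add_distrib, Finset.mul_sum]
  let T : ℝ := max (k * 20 ^ n ^ 2 + A) (∑ j ∈ B, redProc n e j)
  have hT1 : (k:ℝ) * 20 ^ n ^ 2 + A ≤ T := le_max_left _ _
  have hT2 : a + 20 ^ n ^ 2 * (m:ℝ) + E + 200 ^ n ^ 2 * b ≤ T := by
    rw [← spB]; exact le_max_right _ _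
  have hTR : ∀ j ∈ Bᶜ, T ≤ S j := by
    intro j hj
    have hj' : redU2 n A ≤ S j := by
      simpa [hB] using hj
    refine max_le (by rw [← hu2]; exact hj') ?_
    have := aux_len S (redProc n e) hpos hdisj 0 B (fun j _ => hS0 j) (S j) (hS0 j) (by
      intro i hi
      have hi' : S i < redU2 n A := by simpa [hB] using hi
      have hne : i ≠ j := by rintro rfl; linarith
      rcases hdisj i j hne with h | h
      · exact h
      · have := hpos j
        linarith)
    linarith
  have F1 := aux_F S (redProc n e) sm md bg ee (20 ^ n ^ 2) (200 ^ n ^ 2) hP1 hM1 hdisj hee hPM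
    hp hkind T Bᶜ hTR
  have F0 := aux_F S (redProc n e) sm md bg ee (20 ^ n ^ 2) (200 ^ n ^ 2) hP1 hM1 hdisj hee hPM
    hp hkind 0 B (fun j _ => hS0 j)
  rw [split sm, split md, split bg, split ee, split, tsm, tmd, tbg, tee, sa, sM, sb, hHe] at F1
  rw [sa, sM, sb, hHe] at F0
  have hle := add_le_add F1 F0
  rw [sub_add_cancel] at hle
  replace hle := hle.trans hval
  simp only [redV', redVs, redVm, redVb, hu2, hnk] at hle
  have hcardR : (a:ℝ) + b + m ≤ k := by
    have : a + b + m ≤ k := by omega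
    exact_mod_cast this
  have hE2R : (E:ℝ) ≤ 2 * A := by exact_mod_cast hE2
  have hb0 : b = 0 := by
    by_contra hb
    have hb1 : (1:ℝ) ≤ b := by exact_mod_cast Nat.one_le_iff_ne_zero.2 hb
    exact aux_big k _ _ A a b m E T _ _ hk1' hQ hZ hPZ hMZ (by positivity) hAQ (by positivity)
      hb1 (by positivity) hcardR (by positivity) hE2R hT2 hle
  rw [hb0] at hle hT2 hcardR
  simp only [Nat.cast_zero, sub_zero, mul_zero, add_zero] at hle hT2 hcardR
  have hmk : m = k := by
    by_contra hne
    have h1 : m + 1 ≤ k := by omega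
    have h2 : (m:ℝ) ≤ k - 1 := by
      have : (m:ℝ) + 1 ≤ k := by exact_mod_cast h1
      linarith
    exact aux_noBig k _ _ A a m E T _ _ hk1' hQ hZ hPZ hMZ (by positivity) hAQ (by positivity)
      (by positivity) hcardR (by positivity) hE2R h2 hT1 hle
  have ha0 : a = 0 := by omega
  rw [ha0, hmk] at hle hT2
  have h2k : 2 * (k:ℝ) - k = k := by ring
  simp only [Nat.cast_zero, sub_zero, zero_add, h2k] at hle hT2
  refine ⟨H, by rw [hnk, ← hHm, hmk], ?_⟩
  by_contra hne
  refine aux_exact k _ _ A E T _ _ hk1' hQ hZ hPZ hMZ (by positivity) hAQ ?_ hT1 hT2 hle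
  rcases lt_or_gt_of_ne hne with h | h
  · left
    have : (E:ℝ) + 1 ≤ A := by exact_mod_cast h
    linarith
  · right
    exact_mod_cast h
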